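/- arXiv:2007.10803 — 8 statements merged into one kernel-verified Lean document; each statement's English description precedes it below -/
import Mathlib

section
/- Let μ ≥ 0 and ρ > 0, and let x, s ∈ ℝ. Then z(x,s;μ,ρ) ≥ 0, y(x,s;μ,ρ) ≥ 0, z(x,s;μ,ρ) − x = y(x,s;μ,ρ) − s/ρ, z(x,s;μ,ρ)·y(x,s;μ,ρ) = μ/ρ, and ρ·(y(x,s;μ,ρ) + x − z(x,s;μ,ρ)) = s. -/
noncomputable def zfun (x s μ ρ : ℝ) : ℝ :=
  (1 / (2 * ρ)) * (Real.sqrt ((s - ρ * x) ^ 2 + 4 * ρ * μ) - (s - ρ * x))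

noncomputable def yfun (x s μ ρ : ℝ) : ℝ :=
  (1 / (2 * ρ)) * (Real.sqrt ((s - ρ * x) ^ 2 + 4 * ρ * μ) + (s - ρ * x))

theorem stmt_0 (μ ρ x s : ℝ) (hμ : 0 ≤ μ) (hρ : 0 < ρ) :
    0 ≤ zfun x s μ ρ ∧ 0 ≤ yfun x s μ ρ ∧
    zfun x s μ ρ - x = yfun x s μ ρ - s / ρ ∧
    zfun x s μ ρ * yfun x s μ ρ = μ / ρ ∧
    ρ * (yfun x s μ ρ + x - zfun x s μ ρ) = s := by
  have habs : |s - ρ * x| ≤ √((s - ρ * x) ^ 2 + 4 * ρ * μ) :=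
    Real.abs_le_sqrt (le_add_of_nonneg_right (by positivity))
  have hsq : √((s - ρ * x) ^ 2 + 4 * ρ * μ) ^ 2 = (s - ρ * x) ^ 2 + 4 * ρ * μ :=
    Real.sq_sqrt (by positivity)
  obtain ⟨hneg, hpos⟩ := abs_le.mp habs
  unfold zfun yfun
  generalize √((s - ρ * x) ^ 2 + 4 * ρ * μ) = r at *
  refine ⟨mul_nonneg (by positivity) (by linarith), mul_nonneg (by positivity) (by linarith),
    ?_, ?_, ?_⟩
  · field_simp
    ring
  · field_simp
    linear_combination hsq
  · field_simp
    ring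
end

section
/- Let μ ≥ 0 and ρ > 0, and let x, s ∈ ℝ. Then x ≥ 0, s ≥ 0 and x·s = μ hold simultaneously if and only if z(x,s;μ,ρ) − x = 0. -/
theorem stmt_1 (μ ρ x s : ℝ) (hμ : 0 ≤ μ) (hρ : 0 < ρ) :
    (0 ≤ x ∧ 0 ≤ s ∧ x * s = μ) ↔ zfun x s μ ρ - x = 0 := by
  have key : zfun x s μ ρ - x = 0 ↔
      Real.sqrt ((s - ρ * x) ^ 2 + 4 * ρ * μ) = s + ρ * x := by
    unfold zfun
    rw [sub_eq_zero, one_div, inv_mul_eq_iff_eq_mul₀ (by positivity)]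
    constructor <;> intro h <;> linarith
  rw [key]
  constructor
  · rintro ⟨hx, hs, rfl⟩
    rw [show (s - ρ * x) ^ 2 + 4 * ρ * (x * s) = (s + ρ * x) ^ 2 by ring]
    exact Real.sqrt_sq (by positivity)
  · intro h
    have hsum : 0 ≤ s + ρ * x := h ▸ Real.sqrt_nonneg _
    have hsq := Real.sq_sqrt (show 0 ≤ (s - ρ * x) ^ 2 + 4 * ρ * μ by positivity)
    rw [h] at hsq
    have hxs : x * s = μ := mul_left_cancel₀ hρ.ne' (by linarith)
    have hx : 0 ≤ x := by
      by_contra! hx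
      have hs : 0 < s := by linarith [mul_neg_of_pos_of_neg hρ hx]
      linarith [mul_neg_of_neg_of_pos hx hs]
    have hs : 0 ≤ s := by
      by_contra! hs
      have hx' : 0 < x := pos_of_mul_pos_right (by linarith : 0 < ρ * x) hρ.le
      linarith [mul_neg_of_pos_of_neg hx' hs]
    exact ⟨hx, hs, hxs⟩
end

section
/- Let μ > 0 and ρ > 0, and let s ∈ ℝ be fixed. Then the functions x ↦ z(x,s;μ,ρ) and x ↦ y(x,s;μ,ρ) are differentiable on ℝ, and at every x ∈ ℝ the derivative of x ↦ z(x,s;μ,ρ) equals z(x,s;μ,ρ)/(z(x,s;μ,ρ) + y(x,s;μ,ρ)) and the derivative of x ↦ y(x,s;μ,ρ) equals −y(x,s;μ,ρ)/(z(x,s;μ,ρ) + y(x,s;μ,ρ)). -/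
theorem hasDerivAt_sqrt_sq_add {s μ ρ : ℝ} (hμ : 0 < μ) (hρ : 0 < ρ) (x : ℝ) :
    HasDerivAt (fun t => Real.sqrt ((s - ρ * t) ^ 2 + 4 * ρ * μ))
      (-(ρ * (s - ρ * x)) / Real.sqrt ((s - ρ * x) ^ 2 + 4 * ρ * μ)) x := by
  have hpos : 0 < (s - ρ * x) ^ 2 + 4 * ρ * μ := by positivity
  have hlin : HasDerivAt (fun t => s - ρ * t) (-ρ) x := by
    simpa using ((hasDerivAt_id x).const_mul ρ).const_sub s
  have hsqrt := (Real.sqrt_pos.2 hpos).ne'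
  refine (((hlin.fun_pow 2).add_const (4 * ρ * μ)).sqrt hpos.ne').congr_deriv ?_
  rw [div_eq_div_iff (by positivity) hsqrt]
  push_cast
  ring

theorem zfun_add_yfun {ρ : ℝ} (x s μ : ℝ) :
    zfun x s μ ρ + yfun x s μ ρ = Real.sqrt ((s - ρ * x) ^ 2 + 4 * ρ * μ) / ρ := by
  unfold zfun yfun
  ring

theorem stmt_4 (μ ρ s : ℝ) (hμ : 0 < μ) (hρ : 0 < ρ) : ∀ x : ℝ,
    HasDerivAt (fun t => zfun t s μ ρ)
      (zfun x s μ ρ / (zfun x s μ ρ + yfun x s μ ρ)) x ∧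
    HasDerivAt (fun t => yfun t s μ ρ)
      (-(yfun x s μ ρ / (zfun x s μ ρ + yfun x s μ ρ))) x := by
  intro x
  have hsqrt : Real.sqrt ((s - ρ * x) ^ 2 + 4 * ρ * μ) ≠ 0 :=
    (Real.sqrt_pos.2 (by positivity)).ne'
  have hroot := hasDerivAt_sqrt_sq_add (s := s) hμ hρ x
  have hlin : HasDerivAt (fun t => s - ρ * t) (-ρ) x := by
    simpa using ((hasDerivAt_id x).const_mul ρ).const_sub s
  rw [zfun_add_yfun]
  constructor
  · refine ((hroot.fun_sub hlin).const_mul (1 / (2 * ρ))).congr_deriv ?_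
    unfold zfun
    generalize Real.sqrt ((s - ρ * x) ^ 2 + 4 * ρ * μ) = r at hsqrt ⊢
    field_simp
    ring
  · refine ((hroot.fun_add hlin).const_mul (1 / (2 * ρ))).congr_deriv ?_
    unfold yfun
    generalize Real.sqrt ((s - ρ * x) ^ 2 + 4 * ρ * μ) = r at hsqrt ⊢
    field_simp
    ring
end

section
/- Let μ > 0 and x, s ∈ ℝ be fixed. Then the function ρ ↦ (z(x,s;μ,ρ) − x)² is monotonically nonincreasing on (0,∞); that is, for all 0 < ρ₁ ≤ ρ₂ one has (z(x,s;μ,ρ₂) − x)² ≤ (z(x,s;μ,ρ₁) − x)². -/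
theorem zfun_pos (x s : ℝ) {μ ρ : ℝ} (hμ : 0 < μ) (hρ : 0 < ρ) : 0 < zfun x s μ ρ := by
  have h : s - ρ * x < √((s - ρ * x) ^ 2 + 4 * ρ * μ) :=
    Real.lt_sqrt_of_sq_lt (by linarith [mul_pos hρ hμ])
  exact mul_pos (by positivity) (sub_pos.2 h)

theorem zfun_quadratic_eq (x s : ℝ) {μ ρ : ℝ} (hμ : 0 ≤ μ) (hρ : 0 < ρ) :
    ρ * (zfun x s μ ρ - x) * zfun x s μ ρ = μ - s * zfun x s μ ρ := by
  have h := Real.sq_sqrt (show 0 ≤ (s - ρ * x) ^ 2 + 4 * ρ * μ by positivity)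
  unfold zfun
  generalize √((s - ρ * x) ^ 2 + 4 * ρ * μ) = r at h ⊢
  field_simp
  linear_combination h

theorem sq_le_sq_of_mul_eq_mul {a b p q : ℝ} (hp : 0 < p) (hpq : p ≤ q) (h : p * a = q * b) :
    b ^ 2 ≤ a ^ 2 := by
  have hq : 0 < q := hp.trans_le hpq
  rw [sq_le_sq]
  refine le_of_mul_le_mul_left ?_ hq
  calc q * |b| = p * |a| := by
        rw [← abs_of_pos hq, ← abs_of_pos hp, ← abs_mul, ← abs_mul, h]
    _ ≤ q * |a| := by gcongr

theorem stmt_8 (μ x s : ℝ) (hμ : 0 < μ) :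
    ∀ ρ₁ ρ₂ : ℝ, 0 < ρ₁ → ρ₁ ≤ ρ₂ →
      (zfun x s μ ρ₂ - x) ^ 2 ≤ (zfun x s μ ρ₁ - x) ^ 2 := by
  intro ρ₁ ρ₂ h₁ h₁₂
  have h₂ : 0 < ρ₂ := h₁.trans_le h₁₂
  have hz₁ := zfun_pos x s hμ h₁
  have hz₂ := zfun_pos x s hμ h₂
  have e₁ := zfun_quadratic_eq x s hμ.le h₁
  have e₂ := zfun_quadratic_eq x s hμ.le h₂
  generalize zfun x s μ ρ₁ = z₁ at *
  generalize zfun x s μ ρ₂ = z₂ at *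
  refine sq_le_sq_of_mul_eq_mul (p := ρ₁ * (z₁ * z₂) + μ) (q := ρ₂ * (z₁ * z₂) + μ)
    (by positivity) (by gcongr) ?_
  linear_combination z₂ * e₁ - z₁ * e₂
end

section
/- Let μ > 0 and ρ > 0, and let x ≤ 0. Then the function s ↦ G(x,s;μ,ρ) is strictly monotonically increasing on ℝ and tends to +∞ as s → +∞; in particular sup_{s ∈ ℝ} G(x,s;μ,ρ) = +∞. -/
noncomputable def Gfun (x s μ ρ : ℝ) : ℝ :=
  -μ * Real.log (zfun x s μ ρ) + s * (zfun x s μ ρ - x) + (ρ / 2) * (zfun x s μ ρ - x) ^ 2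

/-- `zfun` solves the stationarity equation of the barrier function in its slack variable. -/
theorem zfun_quadratic (x s : ℝ) {μ ρ : ℝ} (hμ : 0 < μ) (hρ : 0 < ρ) :
    ρ * zfun x s μ ρ ^ 2 + (s - ρ * x) * zfun x s μ ρ = μ := by
  have h := Real.sq_sqrt (show 0 ≤ (s - ρ * x) ^ 2 + 4 * ρ * μ by positivity)
  unfold zfun
  set r := Real.sqrt ((s - ρ * x) ^ 2 + 4 * ρ * μ)
  field_simp
  linear_combination h

/-- `zfun` minimizes the barrier function over positive slacks, with minimal value `Gfun`. -/
theorem Gfun_le (x s : ℝ) {μ ρ w : ℝ} (hμ : 0 < μ) (hρ : 0 < ρ) (hw : 0 < w) :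
    Gfun x s μ ρ ≤ -μ * Real.log w + s * (w - x) + (ρ / 2) * (w - x) ^ 2 := by
  have hz := zfun_pos x s hμ hρ
  have hq := zfun_quadratic x s hμ hρ
  unfold Gfun
  set z := zfun x s μ ρ
  have hlog := Real.log_le_sub_one_of_pos (div_pos hw hz)
  rw [Real.log_div hw.ne' hz.ne'] at hlog
  have h1 : μ * (Real.log w - Real.log z) ≤ (ρ * z + (s - ρ * x)) * (w - z) := by
    calc μ * (Real.log w - Real.log z) ≤ μ * (w / z - 1) := by gcongr
      _ = (ρ * z + (s - ρ * x)) * (w - z) := by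
        rw [← hq]
        field_simp
  nlinarith [mul_nonneg hρ.le (sq_nonneg (w - z))]

theorem Gfun_strictMono {μ ρ x : ℝ} (hμ : 0 < μ) (hρ : 0 < ρ) (hx : x ≤ 0) :
    StrictMono (fun s => Gfun x s μ ρ) := by
  intro s t hst
  have hz := zfun_pos x t hμ hρ
  have h := Gfun_le x s hμ hρ hz
  have hpos : 0 < (t - s) * (zfun x t μ ρ - x) := mul_pos (by linarith) (by linarith)
  simp only
  rw [show Gfun x t μ ρ = -μ * Real.log (zfun x t μ ρ) + t * (zfun x t μ ρ - x)
    + (ρ / 2) * (zfun x t μ ρ - x) ^ 2 from rfl]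
  linarith

theorem log_lower_bound_Gfun {μ ρ x s : ℝ} (hμ : 0 < μ) (hρ : 0 < ρ) (hx : x ≤ 0) (hs : 0 < s) :
    μ * (Real.log s - Real.log μ) ≤ Gfun x s μ ρ := by
  have hz := zfun_pos x s hμ hρ
  have hq := zfun_quadratic x s hμ hρ
  unfold Gfun
  set z := zfun x s μ ρ
  have hsz : s * z ≤ μ := by
    nlinarith [mul_nonneg hρ.le (sq_nonneg z), mul_nonneg (mul_nonneg hρ.le hz.le) (neg_nonneg.2 hx)]
  have hlog := Real.log_le_log (mul_pos hs hz) hsz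
  rw [Real.log_mul hs.ne' hz.ne'] at hlog
  have h1 : 0 ≤ s * (z - x) := mul_nonneg hs.le (by linarith)
  have h2 : 0 ≤ (ρ / 2) * (z - x) ^ 2 := by positivity
  nlinarith [mul_le_mul_of_nonneg_left hlog hμ.le]

theorem Gfun_tendsto_atTop {μ ρ x : ℝ} (hμ : 0 < μ) (hρ : 0 < ρ) (hx : x ≤ 0) :
    Filter.Tendsto (fun s => Gfun x s μ ρ) Filter.atTop Filter.atTop := by
  have h : Filter.Tendsto (fun s => μ * (Real.log s - Real.log μ)) Filter.atTop Filter.atTop :=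
    (Filter.tendsto_atTop_add_const_right _ (-Real.log μ) Real.tendsto_log_atTop).const_mul_atTop hμ
  refine Filter.tendsto_atTop_mono' _ ?_ h
  filter_upwards [Filter.eventually_gt_atTop 0] with s hs
  exact log_lower_bound_Gfun hμ hρ hx hs

theorem stmt_14 (μ ρ x : ℝ) (hμ : 0 < μ) (hρ : 0 < ρ) (hx : x ≤ 0) :
    StrictMono (fun s => Gfun x s μ ρ) ∧
    Filter.Tendsto (fun s => Gfun x s μ ρ) Filter.atTop Filter.atTop ∧
    ¬ BddAbove (Set.range fun s => Gfun x s μ ρ) :=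
  have h := Gfun_tendsto_atTop hμ hρ hx
  ⟨Gfun_strictMono hμ hρ hx, h, Filter.not_bddAbove_of_tendsto_atTop h⟩
end

section
/- Let μ > 0, n, m ∈ ℕ, and let f : ℝⁿ → ℝ and h : ℝⁿ → ℝᵐ be strictly differentiable at a point x* ∈ ℝⁿ with x*_j > 0 for every j = 1,…,n and h(x*) = 0. Suppose x* is a local minimizer of the logarithmic-barrier function x ↦ f(x) − μ·Σ_{j=1}^n ln x_j on the set {x ∈ ℝⁿ : h(x) = 0}, and the derivative Dh(x*) : ℝⁿ → ℝᵐ is surjective (i.e., the gradients ∇h_1(x*),…,∇h_m(x*) are linearly independent). Then there exists λ* ∈ ℝᵐ such that ∇f(x*) − Σ_{i=1}^m λ*_i ∇h_i(x*) − s* = 0, where s* ∈ ℝⁿ is defined by s*_j = μ/x*_j; consequently, for every ρ > 0 and every j, z(x*_j, s*_j; μ, ρ) = x*_j. -/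
theorem zfun_div_self {x μ ρ : ℝ} (hx : 0 < x) (hμ : 0 ≤ μ) (hρ : 0 < ρ) :
    zfun x (μ / x) μ ρ = x := by
  have hsq : (μ / x - ρ * x) ^ 2 + 4 * ρ * μ = (μ / x + ρ * x) ^ 2 := by
    field_simp
    ring
  rw [zfun, hsq, Real.sqrt_sq (by positivity)]
  field_simp
  ring

theorem hasStrictFDerivAt_sum_log {ι : Type*} [Fintype ι] {x : ι → ℝ} (hx : ∀ j, x j ≠ 0) :
    HasStrictFDerivAt (fun y : ι → ℝ => ∑ j, Real.log (y j))
      (∑ j, (x j)⁻¹ • ContinuousLinearMap.proj (R := ℝ) (φ := fun _ : ι => ℝ) j) x :=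
  HasStrictFDerivAt.fun_sum fun j _ => (hasStrictFDerivAt_apply j x).log (hx j)

/-- Lagrange multipliers in normal form: at a regular point of the constraint the multiplier of
the objective can be taken to be `1`. -/
theorem IsLocalExtrOn.exists_multipliers_of_surjective {E ι : Type*} [NormedAddCommGroup E]
    [NormedSpace ℝ E] [CompleteSpace E] [Fintype ι] {φ : E → ℝ} {φ' : E →L[ℝ] ℝ}
    {h : E → ι → ℝ} {h' : E →L[ℝ] (ι → ℝ)} {x₀ : E}
    (hextr : IsLocalExtrOn φ {x | h x = h x₀} x₀) (hh : HasStrictFDerivAt h h' x₀)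
    (hφ : HasStrictFDerivAt φ φ' x₀) (hsurj : Function.Surjective h') :
    ∃ lam : ι → ℝ, ∀ v, φ' v = ∑ i, lam i * h' v i := by
  classical
  obtain ⟨Λ, Λ₀, hne, hΛ⟩ := hextr.exists_linear_map_of_hasStrictFDerivAt hh hφ
  have hΛ₀ : Λ₀ ≠ 0 := by
    rintro rfl
    refine hne (Prod.ext (LinearMap.ext fun w => ?_) rfl)
    obtain ⟨v, rfl⟩ := hsurj w
    simpa using hΛ v
  refine ⟨fun i => -Λ₀⁻¹ * Λ (fun j => if i = j then 1 else 0), fun v => ?_⟩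
  have hv := hΛ v
  rw [LinearMap.pi_apply_eq_sum_univ Λ (h' v)] at hv
  simp only [smul_eq_mul] at hv
  calc φ' v = -Λ₀⁻¹ * ∑ i, h' v i * Λ (fun j => if i = j then 1 else 0) := by
        rw [eq_neg_of_add_eq_zero_left hv]
        field_simp
    _ = _ := by
        rw [Finset.mul_sum]
        exact Finset.sum_congr rfl fun i _ => by ring

theorem stmt_15 (μ : ℝ) (hμ : 0 < μ) (n m : ℕ)
    (f : (Fin n → ℝ) → ℝ) (h : (Fin n → ℝ) → (Fin m → ℝ))
    (xstar : Fin n → ℝ)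
    (f' : (Fin n → ℝ) →L[ℝ] ℝ) (h' : (Fin n → ℝ) →L[ℝ] (Fin m → ℝ))
    (hf : HasStrictFDerivAt f f' xstar) (hh : HasStrictFDerivAt h h' xstar)
    (hxpos : ∀ j, 0 < xstar j) (hfeas : h xstar = 0)
    (hmin : IsLocalMinOn (fun x : Fin n → ℝ => f x - μ * ∑ j, Real.log (x j))
      {x | h x = 0} xstar)
    (hsurj : Function.Surjective h') :
    ∃ lam : Fin m → ℝ,
      (∀ v : Fin n → ℝ,
        f' v - (∑ i, lam i * h' v i) - (∑ j, (μ / xstar j) * v j) = 0) ∧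
      (∀ ρ : ℝ, 0 < ρ → ∀ j, zfun (xstar j) (μ / xstar j) μ ρ = xstar j) := by
  have hφ := hf.sub ((hasStrictFDerivAt_sum_log fun j => (hxpos j).ne').const_mul μ)
  rw [← hfeas] at hmin
  obtain ⟨lam, hlam⟩ :=
    IsLocalExtrOn.exists_multipliers_of_surjective (Or.inl hmin) hh hφ hsurj
  refine ⟨lam, fun v => ?_, fun ρ hρ j => zfun_div_self (hxpos j) hμ.le hρ⟩
  rw [← hlam v]
  simp [Finset.mul_sum, div_eq_mul_inv, mul_assoc]
end

section
/- Let n, m ∈ ℕ and ρ > 0. Let B be a real n×n matrix, let A be a real n×m matrix whose columns are linearly independent (i.e., A·λ = 0 implies λ = 0 for λ ∈ ℝᵐ), and let z, y ∈ ℝⁿ with z_j > 0 and y_j > 0 for all j. Assume that vᵀBv ≥ 0 for every v ∈ ℝⁿ with Aᵀv = 0. If dx ∈ ℝⁿ, dλ ∈ ℝᵐ and ds ∈ ℝⁿ satisfy B·dx − A·dλ − ds = 0, Aᵀ·dx = 0, and ρ·y_j·(dx)_j + z_j·(ds)_j = 0 for all j = 1,…,n, then dx = 0, dλ = 0 and ds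 = 0; in other words, the corresponding (2n+m)×(2n+m) block linear system has only the zero solution, so its coefficient matrix is nonsingular. -/
open Matrix

theorem stmt_16 (n m : ℕ) (ρ : ℝ) (hρ : 0 < ρ)
    (B : Matrix (Fin n) (Fin n) ℝ) (A : Matrix (Fin n) (Fin m) ℝ)
    (hA : ∀ lam : Fin m → ℝ, A.mulVec lam = 0 → lam = 0)
    (z y : Fin n → ℝ) (hz : ∀ j, 0 < z j) (hy : ∀ j, 0 < y j)
    (hB : ∀ v : Fin n → ℝ, A.transpose.mulVec v = 0 → 0 ≤ v ⬝ᵥ B.mulVec v)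
    (dx : Fin n → ℝ) (dlam : Fin m → ℝ) (ds : Fin n → ℝ)
    (h1 : B.mulVec dx - A.mulVec dlam - ds = 0)
    (h2 : A.transpose.mulVec dx = 0)
    (h3 : ∀ j, ρ * y j * dx j + z j * ds j = 0) :
    dx = 0 ∧ dlam = 0 ∧ ds = 0 := by
  have hds : ds = B.mulVec dx - A.mulVec dlam := (sub_eq_zero.mp h1).symm
  have hA0 : dx ⬝ᵥ A.mulVec dlam = 0 := by
    rw [dotProduct_mulVec, ← mulVec_transpose, h2, zero_dotProduct]
  have hnonneg : 0 ≤ dx ⬝ᵥ ds := by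
    rw [hds, dotProduct_sub, hA0, sub_zero]
    exact hB dx h2
  have hprod : ∀ j, z j * (dx j * ds j) = -(ρ * y j * dx j ^ 2) := fun j => by
    linear_combination dx j * h3 j
  have hpos : ∀ j, 0 < ρ * y j := fun j => mul_pos hρ (hy j)
  have hnonpos : ∀ j, dx j * ds j ≤ 0 := fun j => by
    refine nonpos_of_mul_nonpos_right (a := z j) ?_ (hz j)
    rw [hprod j]
    exact neg_nonpos.mpr (mul_nonneg (hpos j).le (sq_nonneg _))
  have hsum : ∑ j, dx j * ds j = 0 :=
    le_antisymm (Finset.sum_nonpos fun j _ => hnonpos j) hnonneg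
  have hterm : ∀ j, dx j * ds j = 0 := fun j =>
    (Finset.sum_eq_zero_iff_of_nonpos fun j _ => hnonpos j).mp hsum j (Finset.mem_univ j)
  have hdx : dx = 0 := by
    funext j
    have h := hprod j
    rw [hterm j, mul_zero, zero_eq_neg] at h
    simpa [(hpos j).ne'] using h
  have hds0 : ds = 0 := by
    funext j
    have h := h3 j
    simpa [hdx, (hz j).ne'] using h
  refine ⟨hdx, hA dlam ?_, hds0⟩
  simpa [hdx, hds0] using h1
end

section
/- Let n, m ∈ ℕ, let f : ℝⁿ → ℝ and h : ℝⁿ → ℝᵐ be differentiable, and for μ > 0, ρ > 0 and w = (x,λ,s) ∈ ℝⁿ×ℝᵐ×ℝⁿ define φ_{(μ,ρ)}(w) = ½‖∇f(x) − Σ_{i=1}^m λ_i ∇h_i(x) − s‖² + ½‖h(x)‖² + ½·Σ_{j=1}^n (z(x_j,s_j;μ,ρ) − x_j)². Then for fixed μ > 0 and w, the function ρ ↦ φ_{(μ,ρ)}(w) is monotonically nonincreasing on (0,∞). Consequently, if μ, μ' > 0, 0 < ρ ≤ ρ', and w, w' satisfy φ_{(μ',ρ)}(w') ≤ φ_{(μ,ρ)}(w),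 then φ_{(μ',ρ')}(w') ≤ φ_{(μ,ρ)}(w). -/
/-- The merit (residual) function φ_{(μ,ρ)}(x,λ,s), with gradients expressed
through Fréchet derivatives in the coordinate directions. -/
noncomputable def phiFun {n m : ℕ} (f : (Fin n → ℝ) → ℝ)
    (h : (Fin n → ℝ) → (Fin m → ℝ)) (μ ρ : ℝ)
    (x : Fin n → ℝ) (lam : Fin m → ℝ) (s : Fin n → ℝ) : ℝ :=
  (1 / 2) * (∑ j, (fderiv ℝ f x (Pi.single j 1)
      - (∑ i, lam i * fderiv ℝ h x (Pi.single j 1) i) - s j) ^ 2)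
  + (1 / 2) * (∑ i, (h x i) ^ 2)
  + (1 / 2) * (∑ j, (zfun (x j) (s j) μ ρ - x j) ^ 2)

/-- The defining complementarity relation `z * y = μ`, with `y = ρ * (z - x) + s`. -/
theorem zfun_mul_eq (x s : ℝ) {μ ρ : ℝ} (hμ : 0 < μ) (hρ : 0 < ρ) :
    zfun x s μ ρ * (ρ * (zfun x s μ ρ - x) + s) = μ := by
  have hsq : Real.sqrt ((s - ρ * x) ^ 2 + 4 * ρ * μ) ^ 2 = (s - ρ * x) ^ 2 + 4 * ρ * μ :=
    Real.sq_sqrt (by positivity)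
  unfold zfun
  generalize Real.sqrt ((s - ρ * x) ^ 2 + 4 * ρ * μ) = r at hsq ⊢
  field_simp
  linear_combination hsq

theorem sq_zfun_sub_le (x s : ℝ) {μ ρ ρ' : ℝ} (hμ : 0 < μ) (hρ : 0 < ρ) (hle : ρ ≤ ρ') :
    (zfun x s μ ρ' - x) ^ 2 ≤ (zfun x s μ ρ - x) ^ 2 := by
  have hρ' : 0 < ρ' := hρ.trans_le hle
  have hz := zfun_pos x s hμ hρ
  have hz' := zfun_pos x s hμ hρ'
  have he := zfun_mul_eq x s hμ hρ
  have he' := zfun_mul_eq x s hμ hρ'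
  have hy := pos_of_mul_pos_right (he.symm ▸ hμ) hz.le
  have hy' := pos_of_mul_pos_right (he'.symm ▸ hμ) hz'.le
  generalize zfun x s μ ρ = z at *
  generalize zfun x s μ ρ' = z' at *
  by_contra! hlt
  have habs : |z - x| < |z' - x| := sq_lt_sq.1 hlt
  rcases le_total 0 (z' - x) with hd | hd
  · rw [abs_of_nonneg hd] at habs
    have hzz : z - x < z' - x := (le_abs_self _).trans_lt habs
    have hyy : ρ * (z - x) + s < ρ' * (z' - x) + s := by
      linarith [mul_lt_mul_of_pos_left hzz hρ, mul_le_mul_of_nonneg_right hle hd]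
    have := mul_lt_mul'' (sub_lt_sub_iff_right x |>.1 hzz) hyy hz.le hy.le
    linarith
  · rw [abs_of_nonpos hd] at habs
    have hzz : z' - x < z - x := by linarith [neg_abs_le (z - x)]
    have hyy : ρ' * (z' - x) + s < ρ * (z - x) + s := by
      linarith [mul_lt_mul_of_pos_left hzz hρ, mul_le_mul_of_nonpos_right hle hd]
    have := mul_lt_mul'' (sub_lt_sub_iff_right x |>.1 hzz) hyy hz'.le hy'.le
    linarith

theorem phiFun_le_of_le {n m : ℕ} (f : (Fin n → ℝ) → ℝ) (h : (Fin n → ℝ) → (Fin m → ℝ))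
    {μ ρ ρ' : ℝ} (hμ : 0 < μ) (hρ : 0 < ρ) (hle : ρ ≤ ρ')
    (x : Fin n → ℝ) (lam : Fin m → ℝ) (s : Fin n → ℝ) :
    phiFun f h μ ρ' x lam s ≤ phiFun f h μ ρ x lam s := by
  unfold phiFun
  gcongr _ + 1 / 2 * ?_
  exact Finset.sum_le_sum fun j _ => sq_zfun_sub_le (x j) (s j) hμ hρ hle

theorem stmt_17 (n m : ℕ) (f : (Fin n → ℝ) → ℝ) (h : (Fin n → ℝ) → (Fin m → ℝ))
    (hf : Differentiable ℝ f) (hh : Differentiable ℝ h) :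
    (∀ (μ : ℝ), 0 < μ → ∀ (x : Fin n → ℝ) (lam : Fin m → ℝ) (s : Fin n → ℝ),
      ∀ ρ ρ' : ℝ, 0 < ρ → ρ ≤ ρ' →
        phiFun f h μ ρ' x lam s ≤ phiFun f h μ ρ x lam s) ∧
    (∀ (μ μ' : ℝ), 0 < μ → 0 < μ' → ∀ ρ ρ' : ℝ, 0 < ρ → ρ ≤ ρ' →
      ∀ (x x' : Fin n → ℝ) (lam lam' : Fin m → ℝ) (s s' : Fin n → ℝ),
        phiFun f h μ' ρ x' lam' s' ≤ phiFun f h μ ρ x lam s →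
        phiFun f h μ' ρ' x' lam' s' ≤ phiFun f h μ ρ x lam s) := by
  exact ⟨fun μ hμ x lam s ρ ρ' hρ hle => phiFun_le_of_le f h hμ hρ hle x lam s,
    fun μ μ' _ hμ' ρ ρ' hρ hle x x' lam lam' s s' hphi =>
      (phiFun_le_of_le f h hμ' hρ hle x' lam' s').trans hphi⟩
end
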